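/- (Covariation of pathwise Itô integrals) Let X be continuous with continuous quadratic variation [X] along grids (T_N), and let ξ, ζ be admissible integrands for X. Define Y_t := ∫_0^t ξ_s dX_s and Z_t := ∫_0^t ζ_s dX_s. Then Y and Z are continuous, admit continuous quadratic variations and covariation along (T_N), and [Y, Z]_t = ∫_0^t ξ_s ζ_s d[X]_s for all t ≥ 0. -/

import Mathlib

open Filter Topology Set MeasureTheory

/-- A refining sequence of time grids: each grid is a strictly increasing
sequence starting at 0 and tending to infinity; grids are nested and the
mesh tends to zero. -/
structure GridSeq where
  T : ℕ → ℕ → ℝ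
  zero : ∀ N, T N 0 = 0
  mono : ∀ N, StrictMono (T N)
  unbounded : ∀ N, Filter.Tendsto (T N) Filter.atTop Filter.atTop
  nested : ∀ N, Set.range (T N) ⊆ Set.range (T (N + 1))
  mesh : ∀ ε > 0, ∃ N₀, ∀ N ≥ N₀, ∀ i, T N (i + 1) - T N i ≤ ε

/-- The grid sum `∑_{t_i, t_{i+1} ∈ τ, t_{i+1} ≤ t} f(t_i, t_{i+1})`. -/
noncomputable def gridSum (τ : ℕ → ℝ) (f : ℝ → ℝ → ℝ) (t : ℝ) : ℝ :=
  ∑' i : ℕ, if τ (i + 1) ≤ t then f (τ i) (τ (i + 1)) else 0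

/-- The grid sums of `f` along the grid sequence `G` converge to `L` at time `t`. -/
def ConvTo (G : GridSeq) (f : ℝ → ℝ → ℝ) (t L : ℝ) : Prop :=
  Filter.Tendsto (fun N => gridSum (G.T N) f t) Filter.atTop (nhds L)

/-- `X` has continuous quadratic variation `Q` along the grid sequence `G`. -/
def HasQV (G : GridSeq) (X Q : ℝ → ℝ) : Prop :=
  ContinuousOn Q (Set.Ici 0) ∧ Q 0 = 0 ∧
    ∀ t, ConvTo G (fun u v => (X v - X u) ^ 2) t (Q t)

/-- `A` is locally of finite variation on `[0,∞)`. -/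
def LocBV (A : ℝ → ℝ) : Prop := ∀ T > 0, BoundedVariationOn A (Set.Icc 0 T)

/-- `ξ` is an admissible integrand for `X`: locally `ξ_t = g(A_t, X_t)` with
`g ∈ C¹` and `A` continuous of finite variation. -/
def Admissible (X ξ : ℝ → ℝ) : Prop :=
  ∀ T > 0, ∃ (n : ℕ) (g : (Fin n → ℝ) → ℝ → ℝ) (A : ℝ → Fin n → ℝ),
    ContDiff ℝ 1 (Function.uncurry g) ∧
    (∀ k, ContinuousOn (fun t => A t k) (Set.Icc 0 T) ∧
      BoundedVariationOn (fun t => A t k) (Set.Icc 0 T)) ∧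
    ∀ t ∈ Set.Icc (0 : ℝ) T, ξ t = g (A t) (X t)

/-! ### Grid indices and grid sums -/

namespace GridSeq

lemma exists_lt_succ (G : GridSeq) (N : ℕ) (t : ℝ) : ∃ k, t < G.T N (k + 1) :=
  (((tendsto_add_atTop_iff_nat 1).2 (G.unbounded N)).eventually_gt_atTop t).exists

open Classical in
/-- The index of the last point of the `N`-th grid that is at most `t` (for `t ≥ 0`). -/
noncomputable def idx (G : GridSeq) (N : ℕ) (t : ℝ) : ℕ := Nat.find (G.exists_lt_succ N t)

variable (G : GridSeq)

lemma lt_idx_iff (N : ℕ) (t : ℝ) (i : ℕ) : i < G.idx N t ↔ G.T N (i + 1) ≤ t := by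
  classical
  constructor
  · intro h
    exact not_lt.1 (Nat.find_min (G.exists_lt_succ N t) h)
  · intro h
    by_contra! hi
    have h1 : t < G.T N (G.idx N t + 1) := Nat.find_spec (G.exists_lt_succ N t)
    have h2 : G.T N (G.idx N t + 1) ≤ G.T N (i + 1) := (G.mono N).monotone (by omega)
    linarith

lemma nonneg (N i : ℕ) : 0 ≤ G.T N i := by
  rw [← G.zero N]; exact (G.mono N).monotone (Nat.zero_le i)

lemma step_le (N i : ℕ) : G.T N i ≤ G.T N (i + 1) := (G.mono N).monotone (Nat.le_succ i)

lemma idx_mono (N : ℕ) : Monotone (G.idx N) := by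
  intro s t hst
  by_contra! h
  exact lt_irrefl _ ((G.lt_idx_iff N t _).2 (((G.lt_idx_iff N s _).1 h).trans hst))

lemma idx_of_nonpos (N : ℕ) {t : ℝ} (ht : t ≤ 0) : G.idx N t = 0 := by
  by_contra h
  have h1 := (G.lt_idx_iff N t 0).1 (Nat.pos_of_ne_zero h)
  have h2 : G.T N 0 < G.T N (0 + 1) := G.mono N (Nat.lt_succ_self 0)
  rw [G.zero] at h2
  linarith

lemma idx_grid (N j : ℕ) : G.idx N (G.T N j) = j := by
  refine le_antisymm ?_ ?_
  · by_contra! h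
    have := (G.mono N).le_iff_le.1 ((G.lt_idx_iff N _ _).1 h)
    omega
  · rcases j with _ | j
    · exact Nat.zero_le _
    · exact (G.lt_idx_iff N _ _).2 le_rfl

lemma idx_le (N : ℕ) {t : ℝ} (ht : 0 ≤ t) : G.T N (G.idx N t) ≤ t := by
  rcases h : G.idx N t with _ | k
  · rwa [G.zero]
  · exact (G.lt_idx_iff N t k).1 (by omega)

lemma lt_idx_succ (N : ℕ) (t : ℝ) : t < G.T N (G.idx N t + 1) := by
  by_contra! h
  exact lt_irrefl _ ((G.lt_idx_iff N t _).2 h)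

lemma tendsto_idx {t : ℝ} (ht : 0 ≤ t) :
    Tendsto (fun N => G.T N (G.idx N t)) atTop (𝓝 t) := by
  rw [Metric.tendsto_atTop]
  intro ε hε
  obtain ⟨N₀, hN₀⟩ := G.mesh (ε / 2) (by positivity)
  refine ⟨N₀, fun N hN => ?_⟩
  have h1 := hN₀ N hN (G.idx N t)
  have h2 := G.idx_le N ht
  have h3 := G.lt_idx_succ N t
  rw [Real.dist_eq, abs_lt]
  constructor <;> linarith

lemma tendsto_comp_idx {f : ℝ → ℝ} (hf : ContinuousOn f (Ici 0)) {t : ℝ} (ht : 0 ≤ t) :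
    Tendsto (fun N => f (G.T N (G.idx N t))) atTop (𝓝 (f t)) :=
  (hf t ht).tendsto.comp (tendsto_nhdsWithin_iff.2
    ⟨G.tendsto_idx ht, Eventually.of_forall fun N => G.nonneg N _⟩)

lemma eventually_mesh {ε : ℝ} (hε : 0 < ε) :
    ∀ᶠ N in atTop, ∀ i, G.T N (i + 1) - G.T N i ≤ ε := by
  obtain ⟨N₀, h⟩ := G.mesh ε hε
  exact eventually_atTop.2 ⟨N₀, h⟩

/-- A point of a grid belongs to all later grids. -/
lemma grid_idx_of_mem {N M : ℕ} (hNM : N ≤ M) {s : ℝ} (hs : s ∈ range (G.T N)) :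
    G.T M (G.idx M s) = s := by
  obtain ⟨j, rfl⟩ := monotone_nat_of_le_succ G.nested hNM hs
  rw [idx_grid]

end GridSeq

lemma gridSum_eq (G : GridSeq) (N : ℕ) (f : ℝ → ℝ → ℝ) (t : ℝ) :
    gridSum (G.T N) f t = ∑ i ∈ Finset.range (G.idx N t), f (G.T N i) (G.T N (i + 1)) := by
  unfold gridSum
  rw [tsum_eq_sum (s := Finset.range (G.idx N t))]
  · refine Finset.sum_congr rfl fun i hi => if_pos ?_
    exact (G.lt_idx_iff N t i).1 (Finset.mem_range.1 hi)
  · intro i hi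
    refine if_neg fun h => hi ?_
    exact Finset.mem_range.2 ((G.lt_idx_iff N t i).2 h)

lemma gridSum_sub (G : GridSeq) (N : ℕ) (f : ℝ → ℝ → ℝ) {s t : ℝ} (hst : s ≤ t) :
    gridSum (G.T N) f t - gridSum (G.T N) f s =
      ∑ i ∈ Finset.Ico (G.idx N s) (G.idx N t), f (G.T N i) (G.T N (i + 1)) := by
  rw [gridSum_eq, gridSum_eq, Finset.sum_Ico_eq_sub _ (G.idx_mono N hst)]

lemma gridSum_of_nonpos (G : GridSeq) (N : ℕ) (f : ℝ → ℝ → ℝ) {t : ℝ} (ht : t ≤ 0) :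
    gridSum (G.T N) f t = 0 := by
  rw [gridSum_eq, G.idx_of_nonpos N ht, Finset.sum_range_zero]

lemma gridSum_mono (G : GridSeq) (N : ℕ) {f : ℝ → ℝ → ℝ} (hf : ∀ u v, u ≤ v → 0 ≤ f u v) :
    Monotone (gridSum (G.T N) f) := by
  intro s t hst
  rw [← sub_nonneg, gridSum_sub G N f hst]
  exact Finset.sum_nonneg fun i _ => hf _ _ (G.step_le N i)

lemma ConvTo.eq_zero {G : GridSeq} {f : ℝ → ℝ → ℝ} {t L : ℝ} (h : ConvTo G f t L)
    (ht : t ≤ 0) : L = 0 := by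
  refine tendsto_nhds_unique h ?_
  simp only [gridSum_of_nonpos G _ f ht]
  exact tendsto_const_nhds

lemma convTo_zero_of_nonpos (G : GridSeq) (f : ℝ → ℝ → ℝ) {t : ℝ} (ht : t ≤ 0) :
    ConvTo G f t 0 := by
  unfold ConvTo
  simp only [gridSum_of_nonpos G _ f ht]
  exact tendsto_const_nhds

lemma ConvTo.add {G : GridSeq} {f g : ℝ → ℝ → ℝ} {t L M : ℝ} (hf : ConvTo G f t L)
    (hg : ConvTo G g t M) : ConvTo G (fun u v => f u v + g u v) t (L + M) := by
  refine (Tendsto.add hf hg).congr fun N => ?_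
  simp only [gridSum_eq, Finset.sum_add_distrib]

lemma monotone_of_convTo {G : GridSeq} {f : ℝ → ℝ → ℝ} {Q : ℝ → ℝ}
    (hf : ∀ u v, u ≤ v → 0 ≤ f u v) (h : ∀ t, ConvTo G f t (Q t)) : Monotone Q :=
  fun s t hst => le_of_tendsto_of_tendsto' (h s) (h t) fun N => gridSum_mono G N hf hst

lemma HasQV.monotone {G : GridSeq} {X Q : ℝ → ℝ} (h : HasQV G X Q) : Monotone Q :=
  monotone_of_convTo (fun _ _ _ => sq_nonneg _) h.2.2

lemma convTo_increment (G : GridSeq) {Q : ℝ → ℝ} (hQ : ContinuousOn Q (Ici 0))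
    (hQ0 : ∀ t ≤ 0, Q t = 0) (t : ℝ) : ConvTo G (fun u v => Q v - Q u) t (Q t) := by
  rcases le_or_gt t 0 with ht | ht
  · rw [hQ0 t ht]; exact convTo_zero_of_nonpos G _ ht
  · refine (G.tendsto_comp_idx hQ ht.le).congr fun N => ?_
    rw [gridSum_eq, Finset.sum_range_sub (fun i => Q (G.T N i)), G.zero, hQ0 0 le_rfl, sub_zero]

/-- If two grid sums have products controlled by convergent squares, one of which vanishes,
then the mixed grid sum vanishes. -/
lemma ConvTo.mul_zero_of_sq {G : GridSeq} {f g : ℝ → ℝ → ℝ} {t L : ℝ}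
    (hf : ConvTo G (fun u v => f u v ^ 2) t L) (hg : ConvTo G (fun u v => g u v ^ 2) t 0) :
    ConvTo G (fun u v => f u v * g u v) t 0 := by
  have h := Tendsto.mul hf hg
  rw [mul_zero] at h
  have h2 : Tendsto (fun N => gridSum (G.T N) (fun u v => f u v * g u v) t ^ 2) atTop (𝓝 0) := by
    refine squeeze_zero (fun N => sq_nonneg _) (fun N => ?_) h
    simp only [gridSum_eq]
    exact Finset.sum_mul_sq_le_sq_mul_sq _ _ _
  have h3 := h2.sqrt
  simp only [Real.sqrt_sq_eq_abs, Real.sqrt_zero] at h3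
  exact (tendsto_zero_iff_abs_tendsto_zero _).2 h3

/-! ### Stieltjes limits of weighted grid sums -/

lemma abs_weighted_gridSum_sub_le (G : GridSeq) (N : ℕ) {f : ℝ → ℝ → ℝ} {φ : ℝ → ℝ}
    (hf : ∀ u v, u ≤ v → 0 ≤ f u v) {a b c w : ℝ} (hab : a ≤ b)
    (hφ : ∀ i, a < G.T N (i + 1) → G.T N (i + 1) ≤ b → |φ (G.T N i) - c| ≤ w) :
    |gridSum (G.T N) (fun u v => φ u * f u v) b - gridSum (G.T N) (fun u v => φ u * f u v) a
        - c * (gridSum (G.T N) f b - gridSum (G.T N) f a)|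
      ≤ w * (gridSum (G.T N) f b - gridSum (G.T N) f a) := by
  rw [gridSum_sub G N _ hab, gridSum_sub G N _ hab, Finset.mul_sum, Finset.mul_sum,
    ← Finset.sum_sub_distrib]
  refine (Finset.abs_sum_le_sum_abs _ _).trans (Finset.sum_le_sum fun i hi => ?_)
  rw [Finset.mem_Ico] at hi
  have h0 := hf _ _ (G.step_le N i)
  have h1 : a < G.T N (i + 1) := by
    by_contra! h
    have := (G.lt_idx_iff N a i).2 h
    omega
  rw [← sub_mul, abs_mul, abs_of_nonneg h0]
  exact mul_le_mul_of_nonneg_right (hφ i h1 ((G.lt_idx_iff N b i).1 hi.2)) h0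

lemma exists_uniform_modulus {φ : ℝ → ℝ} (hφ : ContinuousOn φ (Ici 0)) (T : ℝ) {ε : ℝ}
    (hε : 0 < ε) : ∃ δ > 0, ∀ u ∈ Icc 0 T, ∀ v ∈ Icc 0 T, |u - v| ≤ δ → |φ u - φ v| ≤ ε := by
  have h := isCompact_Icc.uniformContinuousOn_of_continuous
    (hφ.mono (Icc_subset_Ici_self : Icc 0 T ⊆ Ici 0))
  obtain ⟨δ, hδ, h⟩ := Metric.uniformContinuousOn_iff.1 h ε hε
  refine ⟨δ / 2, by positivity, fun u hu v hv huv => (h u hu v hv ?_).le⟩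
  rw [Real.dist_eq]
  linarith

lemma exists_approx_weighted_gridSum (G : GridSeq) {Q φ : ℝ → ℝ} (hQ : Monotone Q)
    (hQ0 : Q 0 = 0) (hφ : ContinuousOn φ (Ici 0)) {t : ℝ} (ht : 0 < t) {ε : ℝ} (hε : 0 < ε) :
    ∃ L, ∀ f : ℝ → ℝ → ℝ, (∀ u v, u ≤ v → 0 ≤ f u v) → (∀ s, ConvTo G f s (Q s)) →
      ∀ᶠ N in atTop, |gridSum (G.T N) (fun u v => φ u * f u v) t - L| ≤ ε := by
  have hQt : 0 ≤ Q t := hQ0 ▸ hQ ht.le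
  set w := ε / (2 * (Q t + 1)) with hw
  have hwpos : 0 < w := by positivity
  obtain ⟨δ, hδ, hmod⟩ := exists_uniform_modulus hφ t hwpos
  obtain ⟨n, hn⟩ := exists_nat_gt (t / δ)
  have hn0 : (0 : ℝ) < n := lt_of_le_of_lt (by positivity) hn
  have hstep : t / n ≤ δ := by
    rw [div_lt_iff₀ hδ] at hn
    rw [div_le_iff₀ hn0]; linarith
  set p : ℕ → ℝ := fun j => j * (t / n) with hp
  have hpn : p n = t := by simp only [hp]; field_simp
  have hp0 : p 0 = 0 := by simp [hp]
  have hps : ∀ j, p (j + 1) = p j + t / n := fun j => by simp only [hp]; push_cast; ring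
  have htn : 0 < t / n := by positivity
  have hpnn : ∀ j, 0 ≤ p j := fun j => by simp only [hp]; positivity
  have hpm : Monotone p := monotone_nat_of_le_succ fun j => by rw [hps]; linarith
  refine ⟨∑ j ∈ Finset.range n, φ (p j) * (Q (p (j + 1)) - Q (p j)), fun f hf hfQ => ?_⟩
  have hlim : Tendsto (fun N => ∑ j ∈ Finset.range n,
      φ (p j) * (gridSum (G.T N) f (p (j + 1)) - gridSum (G.T N) f (p j))) atTop
      (𝓝 (∑ j ∈ Finset.range n, φ (p j) * (Q (p (j + 1)) - Q (p j)))) :=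
    tendsto_finsetSum _ fun j _ => ((hfQ _).sub (hfQ _)).const_mul _
  have hev := Metric.tendsto_nhds.1 hlim (ε / 2) (by positivity)
  have hev2 := (hfQ t).eventually (gt_mem_nhds (show Q t < Q t + 1 by linarith))
  filter_upwards [hev, hev2, G.eventually_mesh hδ] with N h1 h2 h3
  rw [Real.dist_eq] at h1
  have key : |gridSum (G.T N) (fun u v => φ u * f u v) t - ∑ j ∈ Finset.range n,
      φ (p j) * (gridSum (G.T N) f (p (j + 1)) - gridSum (G.T N) f (p j))|
      ≤ w * gridSum (G.T N) f t := by
    have e1 : ∀ F : ℝ → ℝ → ℝ, gridSum (G.T N) F t = ∑ j ∈ Finset.range n,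
        (gridSum (G.T N) F (p (j + 1)) - gridSum (G.T N) F (p j)) := fun F => by
      rw [Finset.sum_range_sub (fun j => gridSum (G.T N) F (p j)), hpn, hp0,
        gridSum_of_nonpos G N F le_rfl, sub_zero]
    rw [e1 (fun u v => φ u * f u v), e1 f, Finset.mul_sum, ← Finset.sum_sub_distrib]
    refine (Finset.abs_sum_le_sum_abs _ _).trans (Finset.sum_le_sum fun j hj => ?_)
    have hjn : p (j + 1) ≤ t := by
      rw [← hpn]; exact hpm (Finset.mem_range.1 hj)
    have hjj := hps j
    refine abs_weighted_gridSum_sub_le G N hf (hpm (Nat.le_succ j)) fun i hi1 hi2 => ?_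
    have h4 := G.step_le N i
    have h5 := h3 i
    refine hmod _ ⟨G.nonneg N i, by linarith⟩ _ ⟨hpnn j, by linarith⟩ ?_
    rw [abs_le]
    constructor <;> linarith
  have hwQ : w * (Q t + 1) = ε / 2 := by rw [hw]; field_simp
  have : w * gridSum (G.T N) f t ≤ ε / 2 := by
    rw [← hwQ]; exact mul_le_mul_of_nonneg_left h2.le hwpos.le
  have h6 := abs_sub_le (gridSum (G.T N) (fun u v => φ u * f u v) t) (∑ j ∈ Finset.range n,
      φ (p j) * (gridSum (G.T N) f (p (j + 1)) - gridSum (G.T N) f (p j)))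
      (∑ j ∈ Finset.range n, φ (p j) * (Q (p (j + 1)) - Q (p j)))
  linarith

/-- Weighted grid sums converge to a Stieltjes integral `R` depending only on the distribution
function `Q` and the weight `φ`. -/
lemma exists_weighted_limit (G : GridSeq) {Q φ : ℝ → ℝ} (hQm : Monotone Q)
    (hQc : ContinuousOn Q (Ici 0)) (hQ0 : ∀ t ≤ 0, Q t = 0) (hφ : ContinuousOn φ (Ici 0)) :
    ∃ R : ℝ → ℝ, ContinuousOn R (Ici 0) ∧ R 0 = 0 ∧
      ∀ f : ℝ → ℝ → ℝ, (∀ u v, u ≤ v → 0 ≤ f u v) → (∀ s, ConvTo G f s (Q s)) →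
        ∀ t, ConvTo G (fun u v => φ u * f u v) t (R t) := by
  have hincr : ∀ u v, u ≤ v → 0 ≤ Q v - Q u := fun u v h => sub_nonneg.2 (hQm h)
  have hincrQ := convTo_increment G hQc hQ0
  have hex : ∀ t, ∃ r, ConvTo G (fun u v => φ u * (Q v - Q u)) t r := by
    intro t
    rcases le_or_gt t 0 with ht | ht
    · exact ⟨0, convTo_zero_of_nonpos G _ ht⟩
    · refine cauchySeq_tendsto_of_complete (Metric.cauchySeq_iff'.2 fun ε hε => ?_)
      obtain ⟨L, hL⟩ := exists_approx_weighted_gridSum G hQm (hQ0 0 le_rfl) hφ ht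
        (show 0 < ε / 3 by positivity)
      obtain ⟨N, hN⟩ := eventually_atTop.1 (hL _ hincr hincrQ)
      refine ⟨N, fun n hn => ?_⟩
      have h1 := abs_le.1 (hN n hn)
      have h2 := abs_le.1 (hN N le_rfl)
      rw [Real.dist_eq, abs_lt]
      constructor <;> linarith [h1.1, h1.2, h2.1, h2.2]
  choose R hR using hex
  refine ⟨R, ?_, (hR 0).eq_zero le_rfl, fun f hf hfQ t => ?_⟩
  · have hbd : ∀ T, ∃ C, ∀ s t, 0 ≤ s → s ≤ t → t ≤ T → |R t - R s| ≤ C * (Q t - Q s) := by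
      intro T
      obtain ⟨C, hC⟩ := isCompact_Icc.exists_bound_of_continuousOn
        (hφ.mono (Icc_subset_Ici_self : Icc 0 T ⊆ Ici 0))
      refine ⟨C, fun s t hs hst htT => ?_⟩
      refine le_of_tendsto_of_tendsto' ((hR t).sub (hR s)).abs
        (((hincrQ t).sub (hincrQ s)).const_mul C) fun N => ?_
      have := abs_weighted_gridSum_sub_le G N (φ := φ) hincr (c := 0) (w := C) hst
        (fun i _ hi => by
          rw [sub_zero]
          exact hC _ ⟨G.nonneg N i, ((G.step_le N i).trans hi).trans htT⟩)
      rwa [zero_mul, sub_zero] at this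
    intro t ht
    obtain ⟨C, hC⟩ := hbd (t + 1)
    have hlim : Tendsto (fun s => C * |Q s - Q t|) (𝓝[Ici 0] t) (𝓝 0) := by
      have := (((hQc t ht).tendsto.sub_const (Q t)).abs).const_mul C
      simpa using this
    rw [ContinuousWithinAt, tendsto_iff_dist_tendsto_zero]
    refine squeeze_zero' (Eventually.of_forall fun _ => dist_nonneg) ?_ hlim
    filter_upwards [self_mem_nhdsWithin,
      mem_nhdsWithin_of_mem_nhds (gt_mem_nhds (show t < t + 1 by linarith))] with s hs hs1
    rw [Real.dist_eq]
    rcases le_total s t with h | h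
    · rw [abs_sub_comm, abs_sub_comm (Q s), abs_of_nonneg (hincr s t h)]
      exact hC s t hs h (by linarith)
    · rw [abs_of_nonneg (hincr t s h)]
      exact hC t s ht h (le_of_lt hs1)
  · rcases le_or_gt t 0 with ht | ht
    · rw [(hR t).eq_zero ht]; exact convTo_zero_of_nonpos G _ ht
    · have hdiff : Tendsto (fun N => gridSum (G.T N) (fun u v => φ u * f u v) t
          - gridSum (G.T N) (fun u v => φ u * (Q v - Q u)) t) atTop (𝓝 0) := by
        rw [Metric.tendsto_nhds]
        intro ε hε
        obtain ⟨L, hL⟩ := exists_approx_weighted_gridSum G hQm (hQ0 0 le_rfl) hφ ht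
          (show 0 < ε / 3 by positivity)
        filter_upwards [hL _ hincr hincrQ, hL f hf hfQ] with N h1 h2
        rw [abs_le] at h1 h2
        rw [Real.dist_eq, abs_lt]
        constructor <;> linarith [h1.1, h1.2, h2.1, h2.2]
      have := hdiff.add (hR t)
      simpa [ConvTo] using this

/-! ### Discrete Itô estimate -/

/-- Second-order remainder of the discrete integral of a Lipschitz function. -/
lemma abs_discrete_integral_sub_le {E : Type*} [NormedAddCommGroup E] {g : E × ℝ → ℝ} {K δ : ℝ}
    (hgc : Continuous g)
    (hg : ∀ a x b y, |g (a, x) - g (b, y)| ≤ K * (‖a - b‖ + |x - y|)) (hK : 0 ≤ K)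
    (a : ℕ → E) (x : ℕ → ℝ) {m k : ℕ} (hmk : m ≤ k)
    (hδ : ∀ i, m ≤ i → i ≤ k → |x i - x m| ≤ δ) :
    |∑ i ∈ Finset.Ico m k, g (a i, x i) * (x (i + 1) - x i) - g (a m, x m) * (x k - x m)|
      ≤ K * (∑ i ∈ Finset.Ico m k, (x (i + 1) - x i) ^ 2 + (x k - x m) ^ 2
          + δ * (∑ i ∈ Finset.Ico m k, ‖a (i + 1) - a i‖ + ‖a k - a m‖)) := by
  set F : E → ℝ → ℝ := fun b z => ∫ y in x m..z, g (b, y) with hF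
  have hint : ∀ b u v, IntervalIntegrable (fun y => g (b, y)) volume u v := fun b u v =>
    (hgc.comp (by fun_prop : Continuous fun y : ℝ => (b, y))).intervalIntegrable u v
  have hpoint : ∀ b c u v, |(∫ y in u..v, g (b, y)) - g (c, u) * (v - u)|
      ≤ K * (‖b - c‖ + |v - u|) * |v - u| := by
    intro b c u v
    have e : (∫ y in u..v, g (b, y)) - g (c, u) * (v - u)
        = ∫ y in u..v, (g (b, y) - g (c, u)) := by
      rw [intervalIntegral.integral_sub (hint b u v) intervalIntegrable_const,
        intervalIntegral.integral_const, smul_eq_mul, mul_comm (v - u)]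
    rw [e, ← Real.norm_eq_abs]
    refine intervalIntegral.norm_integral_le_of_norm_le_const fun y hy => ?_
    refine (hg b y c u).trans (mul_le_mul_of_nonneg_left (add_le_add le_rfl ?_) hK)
    exact abs_sub_left_of_mem_uIcc (uIoc_subset_uIcc hy)
  have hparam : ∀ b c z, |F b z - F c z| ≤ K * ‖b - c‖ * |z - x m| := by
    intro b c z
    rw [hF, ← intervalIntegral.integral_sub (hint b _ _) (hint c _ _), ← Real.norm_eq_abs]
    refine intervalIntegral.norm_integral_le_of_norm_le_const fun y _ => ?_
    simpa using hg b y c y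
  have hstep : ∀ k, m ≤ k → (∀ i, m ≤ i → i ≤ k → |x i - x m| ≤ δ) →
      |F (a k) (x k) - ∑ i ∈ Finset.Ico m k, g (a i, x i) * (x (i + 1) - x i)|
        ≤ K * (∑ i ∈ Finset.Ico m k, (x (i + 1) - x i) ^ 2
          + δ * ∑ i ∈ Finset.Ico m k, ‖a (i + 1) - a i‖) := by
    intro k hk
    induction k, hk using Nat.le_induction with
    | base => intro _; simp [hF]
    | succ k hk ih =>
      intro h
      have ih := ih fun i h1 h2 => h i h1 (by omega)
      rw [Finset.sum_Ico_succ_top hk, Finset.sum_Ico_succ_top hk, Finset.sum_Ico_succ_top hk]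
      have h1 := hparam (a (k + 1)) (a k) (x (k + 1))
      have h2 : K * ‖a (k + 1) - a k‖ * |x (k + 1) - x m| ≤ K * ‖a (k + 1) - a k‖ * δ :=
        mul_le_mul_of_nonneg_left (h (k + 1) (by omega) le_rfl) (by positivity)
      have h3 := hpoint (a k) (a k) (x k) (x (k + 1))
      have h4 : F (a k) (x (k + 1)) - F (a k) (x k) = ∫ y in x k..x (k + 1), g (a k, y) :=
        intervalIntegral.integral_interval_sub_left (hint _ _ _) (hint _ _ _)
      rw [← h4, sub_self, norm_zero, zero_add, mul_assoc, abs_mul_abs_self, ← sq] at h3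
      rw [abs_le] at *
      constructor <;> linarith [h1.1, h1.2, h3.1, h3.2, ih.1, ih.2]
  have h1 := hstep k hmk hδ
  have h2 := hpoint (a k) (a m) (x m) (x k)
  have h3 : K * (‖a k - a m‖ + |x k - x m|) * |x k - x m|
      ≤ K * ((x k - x m) ^ 2 + δ * ‖a k - a m‖) := by
    rw [mul_assoc]
    refine mul_le_mul_of_nonneg_left ?_ hK
    rw [add_mul, abs_mul_abs_self, ← sq, add_comm, mul_comm δ]
    gcongr
    exact hδ k hmk le_rfl
  change |F (a k) (x k) - _| ≤ _ at h2
  rw [abs_le] at *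
  constructor <;> linarith [h1.1, h1.2, h2.1, h2.2]

/-! ### Local structure of admissible integrands -/

/-- A path controlled by a monotone function in each coordinate. -/
lemma exists_monotone_control {n : ℕ} {A : ℝ → Fin n → ℝ} {S : Set ℝ}
    (hA : ∀ k, BoundedVariationOn (fun t => A t k) S) :
    ∃ V : ℝ → ℝ, MonotoneOn V S ∧
      ∀ s ∈ S, ∀ t ∈ S, s ≤ t → ‖A t - A s‖ ≤ V t - V s := by
  choose p q hp hq hpq using fun k =>
    (hA k).locallyBoundedVariationOn.exists_monotoneOn_sub_monotoneOn
  have hnn : ∀ s ∈ S, ∀ t ∈ S, s ≤ t → ∀ k, 0 ≤ (p k t + q k t) - (p k s + q k s) :=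
    fun s hs t ht hst k => by linarith [hp k hs ht hst, hq k hs ht hst]
  refine ⟨fun t => ∑ k, (p k t + q k t), fun s hs t ht hst =>
    Finset.sum_le_sum fun k _ => sub_nonneg.1 (hnn s hs t ht hst k), fun s hs t ht hst => ?_⟩
  rw [← Finset.sum_sub_distrib]
  refine (pi_norm_le_iff_of_nonneg (Finset.sum_nonneg fun k _ => hnn s hs t ht hst k)).2
    fun k => ?_
  refine le_trans ?_ (Finset.single_le_sum (fun j _ => hnn s hs t ht hst j) (Finset.mem_univ k))
  have e : ∀ r, A r k = p k r - q k r := fun r => congrFun (hpq k) r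
  rw [Pi.sub_apply, Real.norm_eq_abs, e, e, abs_le]
  constructor <;> linarith [hp k hs ht hst, hq k hs ht hst]

/-- On a compact interval, an admissible integrand is a globally Lipschitz function of `(A, X)`. -/
lemma Admissible.exists_lipschitz {X ξ : ℝ → ℝ} (hX : ContinuousOn X (Ici 0))
    (hξ : Admissible X ξ) {T : ℝ} (hT : 0 < T) :
    ∃ (n : ℕ) (g : (Fin n → ℝ) × ℝ → ℝ) (A : ℝ → Fin n → ℝ) (V : ℝ → ℝ) (K : ℝ),
      0 ≤ K ∧ Continuous g ∧
      (∀ a x b y, |g (a, x) - g (b, y)| ≤ K * (‖a - b‖ + |x - y|)) ∧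
      ContinuousOn A (Icc 0 T) ∧ MonotoneOn V (Icc 0 T) ∧
      (∀ s ∈ Icc 0 T, ∀ t ∈ Icc 0 T, s ≤ t → ‖A t - A s‖ ≤ V t - V s) ∧
      ∀ t ∈ Icc 0 T, ξ t = g (A t, X t) := by
  obtain ⟨n, g, A, hg, hA, hξg⟩ := hξ T hT
  obtain ⟨V, hV, hAV⟩ := exists_monotone_control fun k => (hA k).2
  have hAc : ContinuousOn A (Icc 0 T) := continuousOn_pi.2 fun k => (hA k).1
  have hcomp : IsCompact ((fun t => (A t, X t)) '' Icc 0 T) :=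
    isCompact_Icc.image_of_continuousOn (hAc.prodMk (hX.mono Icc_subset_Ici_self))
  obtain ⟨K, hK⟩ := hg.locallyLipschitz.locallyLipschitzOn.exists_lipschitzOnWith_of_compact hcomp
  obtain ⟨g', hg', heq⟩ := hK.extend_real
  refine ⟨n, g', A, V, K, K.2, hg'.continuous, fun a x b y => ?_, hAc, hV, hAV, fun t ht => ?_⟩
  · refine (hg'.dist_le_mul (a, x) (b, y)).trans (mul_le_mul_of_nonneg_left ?_ K.2)
    rw [Prod.dist_eq, dist_eq_norm, Real.dist_eq]
    exact max_le_add_of_nonneg (norm_nonneg _) (abs_nonneg _)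
  · rw [hξg t ht, ← heq (mem_image_of_mem _ ht)]
    rfl

lemma Admissible.continuousOn {X ξ : ℝ → ℝ} (hX : ContinuousOn X (Ici 0))
    (hξ : Admissible X ξ) : ContinuousOn ξ (Ici 0) := by
  intro t ht
  have ht0 : 0 ≤ t := ht
  obtain ⟨n, g, A, V, K, -, hg, -, hA, -, -, hξg⟩ :=
    hξ.exists_lipschitz hX (show 0 < t + 1 by linarith)
  have h : ContinuousOn ξ (Icc 0 (t + 1)) :=
    (hg.comp_continuousOn (hA.prodMk (hX.mono Icc_subset_Ici_self))).congr hξg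
  refine (h t ⟨ht, by linarith⟩).mono_of_mem_nhdsWithin ?_
  filter_upwards [self_mem_nhdsWithin,
    mem_nhdsWithin_of_mem_nhds (gt_mem_nhds (show t < t + 1 by linarith))] with s hs hs1
  exact ⟨hs, le_of_lt hs1⟩

/-! ### Local expansion of the pathwise integral -/

/-- The first-order remainder `Y_v - Y_u - ξ_u (X_v - X_u)` of a pathwise integral. -/
def remainder (X ξ Y : ℝ → ℝ) (u v : ℝ) : ℝ := Y v - Y u - ξ u * (X v - X u)

lemma abs_remainder_le {G : GridSeq} {X Q ξ Y : ℝ → ℝ} (hX : ContinuousOn X (Ici 0))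
    (hQ : HasQV G X Q) (hξ : Admissible X ξ)
    (hY : ∀ t, ConvTo G (fun u v => ξ u * (X v - X u)) t (Y t)) {T : ℝ} (hT : 0 < T) :
    ∃ (K : ℝ) (V : ℝ → ℝ), 0 ≤ K ∧ MonotoneOn V (Icc 0 T) ∧ ∀ δ > 0, ∃ η > 0,
      ∀ s t, 0 ≤ s → s ≤ t → t ≤ T → t - s ≤ η →
        |remainder X ξ Y s t| ≤ K * ((Q t - Q s) + (X t - X s) ^ 2 + δ * (V T - V 0)) ∧
        ∀ N, s ∈ range (G.T N) →
          |remainder X ξ Y s t| ≤ K * ((Q t - Q s) + (X t - X s) ^ 2 + δ * (V t - V s)) := by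
  obtain ⟨n, g, A, V, K, hK, hgc, hg, hA, hV, hAV, hξg⟩ := hξ.exists_lipschitz hX hT
  have hξc := hξ.continuousOn hX
  refine ⟨K, V, hK, hV, fun δ hδ => ?_⟩
  obtain ⟨η, hη, hmod⟩ := exists_uniform_modulus hX T (show 0 < δ / 2 by positivity)
  refine ⟨η / 2, by positivity, fun s t hs hst htT hts => ?_⟩
  have ht := hs.trans hst
  have main : ∀ v, (∀ᶠ M in atTop, V t - V (G.T M (G.idx M s)) ≤ v) →
      |remainder X ξ Y s t| ≤ K * ((Q t - Q s) + (X t - X s) ^ 2 + δ * v) := by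
    intro v hv
    have hXs := G.tendsto_comp_idx hX hs
    have hXt := G.tendsto_comp_idx hX ht
    refine le_of_tendsto_of_tendsto
      (((hY t).sub (hY s)).sub ((G.tendsto_comp_idx hξc hs).mul (hXt.sub hXs))).abs
      (((((hQ.2.2 t).sub (hQ.2.2 s)).add ((hXt.sub hXs).pow 2)).add_const (δ * v)).const_mul K) ?_
    filter_upwards [hv, G.eventually_mesh (show 0 < η / 2 by positivity)] with M h1 h2
    have hidx : G.idx M s ≤ G.idx M t := G.idx_mono M hst
    have hle : ∀ i, i ≤ G.idx M t → G.T M i ≤ t := fun i hi =>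
      ((G.mono M).monotone hi).trans (G.idx_le M ht)
    have hmem : ∀ i, i ≤ G.idx M t → G.T M i ∈ Icc 0 T := fun i hi =>
      ⟨G.nonneg M i, (hle i hi).trans htT⟩
    have hdisc := abs_discrete_integral_sub_le (δ := δ / 2) hgc hg hK (fun i => A (G.T M i))
      (fun i => X (G.T M i)) hidx (fun i hi1 hi2 => by
        refine hmod _ (hmem i hi2) _ (hmem _ hidx) ?_
        have h3 := (G.mono M).monotone hi1
        have h4 := G.lt_idx_succ M s
        have h5 := h2 (G.idx M s)
        have h6 := hle i hi2
        rw [abs_of_nonneg (by linarith)]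
        linarith)
    rw [← hξg _ (hmem _ hidx)] at hdisc
    have e1 : ∑ i ∈ Finset.Ico (G.idx M s) (G.idx M t),
        g (A (G.T M i), X (G.T M i)) * (X (G.T M (i + 1)) - X (G.T M i))
        = gridSum (G.T M) (fun u v => ξ u * (X v - X u)) t
          - gridSum (G.T M) (fun u v => ξ u * (X v - X u)) s := by
      rw [gridSum_sub G M _ hst]
      refine Finset.sum_congr rfl fun i hi => ?_
      rw [hξg _ (hmem i (Finset.mem_Ico.1 hi).2.le)]
    rw [e1, ← gridSum_sub G M (fun u v => (X v - X u) ^ 2) hst] at hdisc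
    refine hdisc.trans (mul_le_mul_of_nonneg_left (add_le_add le_rfl ?_) hK)
    have e2 : ∑ i ∈ Finset.Ico (G.idx M s) (G.idx M t), ‖A (G.T M (i + 1)) - A (G.T M i)‖
        ≤ V (G.T M (G.idx M t)) - V (G.T M (G.idx M s)) := by
      rw [← Finset.sum_Ico_sub (fun i => V (G.T M i)) hidx]
      refine Finset.sum_le_sum fun i hi => ?_
      have hi2 := (Finset.mem_Ico.1 hi).2
      exact hAV _ (hmem i hi2.le) _ (hmem (i + 1) hi2) (G.step_le M i)
    have e3 := hAV _ (hmem _ hidx) _ (hmem _ le_rfl) ((G.mono M).monotone hidx)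
    have e4 := hV (hmem _ le_rfl) ⟨ht, htT⟩ (G.idx_le M ht)
    calc _ ≤ δ / 2 * (v + v) := mul_le_mul_of_nonneg_left (by linarith) (by positivity)
      _ = δ * v := by ring
  refine ⟨main _ (Eventually.of_forall fun M => ?_), fun N hN => main _ ?_⟩
  · have h1 := G.idx_le M hs
    have h2 := hV ⟨ht, htT⟩ ⟨hT.le, le_rfl⟩ htT
    have h3 := hV ⟨le_rfl, hT.le⟩ ⟨G.nonneg M (G.idx M s), by linarith⟩ (G.nonneg M _)
    linarith
  · filter_upwards [eventually_ge_atTop N] with M hM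
    rw [GridSeq.grid_idx_of_mem G hM hN]

lemma continuousOn_pathwise_integral {G : GridSeq} {X Q ξ Y : ℝ → ℝ}
    (hX : ContinuousOn X (Ici 0)) (hQ : HasQV G X Q) (hξ : Admissible X ξ)
    (hY : ∀ t, ConvTo G (fun u v => ξ u * (X v - X u)) t (Y t)) : ContinuousOn Y (Ici 0) := by
  intro r hr
  have hr0 : 0 ≤ r := hr
  have hT : 0 < r + 1 := by linarith
  obtain ⟨K, V, hK, hV, hrem⟩ := abs_remainder_le hX hQ hξ hY hT
  obtain ⟨C, hC⟩ := isCompact_Icc.exists_bound_of_continuousOn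
    ((hξ.continuousOn hX).mono (Icc_subset_Ici_self : Icc 0 (r + 1) ⊆ Ici 0))
  have hC0 : 0 ≤ C := (norm_nonneg _).trans (hC 0 ⟨le_rfl, hT.le⟩)
  have hV0 : 0 ≤ V (r + 1) - V 0 :=
    sub_nonneg.2 (hV ⟨le_rfl, hT.le⟩ ⟨hT.le, le_rfl⟩ hT.le)
  rw [Metric.continuousWithinAt_iff']
  intro ε hε
  set δ := ε / (2 * (K * (V (r + 1) - V 0) + 1)) with hδ
  have hδ0 : 0 < δ := by positivity
  have hδε : K * (δ * (V (r + 1) - V 0)) ≤ ε / 2 := by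
    have : δ * (K * (V (r + 1) - V 0) + 1) = ε / 2 := by rw [hδ]; field_simp
    linarith
  obtain ⟨η, hη, h⟩ := hrem δ hδ0
  have hlim : Tendsto (fun s => C * |X s - X r| + K * (|Q s - Q r| + (X s - X r) ^ 2))
      (𝓝[Ici 0] r) (𝓝 0) := by
    have hXr := (hX r hr).tendsto.sub_const (X r)
    have hQr := (hQ.1 r hr).tendsto.sub_const (Q r)
    have := (hXr.abs.const_mul C).add ((hQr.abs.add (hXr.pow 2)).const_mul K)
    simpa using this
  have hgen : ∀ s t, 0 ≤ s → s ≤ t → t ≤ r + 1 → t - s ≤ η →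
      |Y t - Y s| ≤ C * |X t - X s| + K * (|Q t - Q s| + (X t - X s) ^ 2) + ε / 2 := by
    intro s t hs hst ht hts
    have h1 := (h s t hs hst ht hts).1
    have h2 : |ξ s * (X t - X s)| ≤ C * |X t - X s| := by
      rw [abs_mul]
      exact mul_le_mul_of_nonneg_right (hC s ⟨hs, hst.trans ht⟩) (abs_nonneg _)
    have h3 : Y t - Y s = remainder X ξ Y s t + ξ s * (X t - X s) := by
      unfold remainder; ring
    have h4 := mul_le_mul_of_nonneg_left (le_abs_self (Q t - Q s)) hK
    rw [h3]
    refine (abs_add_le _ _).trans ?_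
    linarith
  filter_upwards [self_mem_nhdsWithin, hlim.eventually (gt_mem_nhds (half_pos hε)),
    mem_nhdsWithin_of_mem_nhds (Metric.closedBall_mem_nhds r (lt_min hη one_pos))]
    with s hs h1 h2
  rw [Metric.mem_closedBall, Real.dist_eq, le_min_iff, abs_le, abs_le] at h2
  rw [Real.dist_eq]
  rcases le_total s r with hsr | hsr
  · have := hgen s r hs hsr (by linarith) (by linarith [h2.1.1])
    rw [abs_sub_comm, abs_sub_comm (X r), abs_sub_comm (Q r), sub_sq_comm] at this
    linarith
  · have := hgen r s hr hsr (by linarith [h2.2.2]) (by linarith [h2.1.2])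
    linarith

lemma convTo_remainder_sq {G : GridSeq} {X Q ξ Y : ℝ → ℝ}
    (hX : ContinuousOn X (Ici 0)) (hQ : HasQV G X Q) (hξ : Admissible X ξ)
    (hY : ∀ t, ConvTo G (fun u v => ξ u * (X v - X u)) t (Y t)) (t : ℝ) :
    ConvTo G (fun u v => remainder X ξ Y u v ^ 2) t 0 := by
  rcases le_or_gt t 0 with ht | ht
  · exact convTo_zero_of_nonpos G _ ht
  obtain ⟨K, V, hK, hV, hrem⟩ := abs_remainder_le hX hQ hξ hY ht
  have hQt : 0 ≤ Q t := hQ.2.1 ▸ hQ.monotone ht.le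
  set W := V t - V 0 with hW
  have hW0 : 0 ≤ W := sub_nonneg.2 (hV ⟨le_rfl, ht.le⟩ ⟨ht.le, le_rfl⟩ ht.le)
  set B := K * (2 + W) * (K * (2 * Q t + 1 + W)) with hB
  have hB0 : 0 ≤ B := by positivity
  refine Metric.tendsto_nhds.2 fun ε hε => ?_
  set δ := min 1 (ε / (B + 1)) with hδ
  have hδ0 : 0 < δ := by positivity
  have hδ1 : δ ≤ 1 := min_le_left _ _
  have hδε : δ * B < ε := by
    have h1 : δ * (B + 1) ≤ ε := by
      rw [← le_div_iff₀ (by positivity)]; exact min_le_right _ _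
    linarith
  obtain ⟨η₁, hη₁, h⟩ := hrem δ hδ0
  obtain ⟨η₂, hη₂, hXm⟩ := exists_uniform_modulus hX t hδ0
  obtain ⟨η₃, hη₃, hQm⟩ := exists_uniform_modulus hQ.1 t hδ0
  filter_upwards [G.eventually_mesh hη₁, G.eventually_mesh hη₂, G.eventually_mesh hη₃,
    (hQ.2.2 t).eventually (gt_mem_nhds (show Q t < Q t + 1 by linarith))] with N m1 m2 m3 hN
  rw [gridSum_eq] at hN ⊢
  set k := G.idx N t with hk
  have hmem : ∀ i, i ≤ k → G.T N i ∈ Icc 0 t := fun i hi =>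
    ⟨G.nonneg N i, ((G.mono N).monotone hi).trans (G.idx_le N ht.le)⟩
  have hmono := hQ.monotone
  have hterm : ∀ i ∈ Finset.range k, remainder X ξ Y (G.T N i) (G.T N (i + 1)) ^ 2
      ≤ δ * (K * (2 + W)) * (K * ((Q (G.T N (i + 1)) - Q (G.T N i))
        + (X (G.T N (i + 1)) - X (G.T N i)) ^ 2 + (V (G.T N (i + 1)) - V (G.T N i)))) := by
    intro i hi
    have hik := Finset.mem_range.1 hi
    have hi0 := hmem i hik.le
    have hi1 := hmem (i + 1) hik
    have hst := G.step_le N i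
    have hb := (h _ _ hi0.1 hst hi1.2 (m1 i)).2 N (mem_range_self i)
    have hΔ : |G.T N (i + 1) - G.T N i| = G.T N (i + 1) - G.T N i :=
      abs_of_nonneg (sub_nonneg.2 hst)
    have hx := hXm _ hi1 _ hi0 (by rw [hΔ]; exact m2 i)
    have hq := hQm _ hi1 _ hi0 (by rw [hΔ]; exact m3 i)
    have hv0 := sub_nonneg.2 (hV hi0 hi1 hst)
    have hv1 : V (G.T N (i + 1)) - V (G.T N i) ≤ W := by
      linarith [hV hi1 ⟨ht.le, le_rfl⟩ hi1.2, hV ⟨le_rfl, ht.le⟩ hi0 hi0.1]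
    have hq0 := sub_nonneg.2 (hmono hst)
    rw [abs_of_nonneg hq0] at hq
    generalize Q (G.T N (i + 1)) - Q (G.T N i) = q at *
    generalize X (G.T N (i + 1)) - X (G.T N i) = x at *
    generalize V (G.T N (i + 1)) - V (G.T N i) = v at *
    have hx2 : x ^ 2 ≤ δ := by
      rw [← sq_abs]; nlinarith [abs_nonneg x]
    rw [← sq_abs, sq]
    have hδv : δ * v ≤ v := by nlinarith
    have hδv' : δ * v ≤ δ * W := mul_le_mul_of_nonneg_left hv1 hδ0.le
    refine mul_le_mul (hb.trans ?_) (hb.trans ?_) (abs_nonneg _) (by positivity)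
    · calc K * (q + x ^ 2 + δ * v) ≤ K * (δ + δ + δ * W) := by gcongr
        _ = δ * (K * (2 + W)) := by ring
    · gcongr
  have hsum := Finset.sum_le_sum hterm
  rw [← Finset.mul_sum, ← Finset.mul_sum, Finset.sum_add_distrib, Finset.sum_add_distrib,
    Finset.sum_range_sub (fun i => Q (G.T N i)), Finset.sum_range_sub (fun i => V (G.T N i)),
    G.zero, hQ.2.1, sub_zero] at hsum
  have hQk := hmono (hmem k le_rfl).2
  have hVk := hV (hmem k le_rfl) ⟨ht.le, le_rfl⟩ (hmem k le_rfl).2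
  rw [Real.dist_eq, sub_zero, abs_of_nonneg (Finset.sum_nonneg fun _ _ => sq_nonneg _)]
  refine lt_of_le_of_lt (hsum.trans ?_) hδε
  calc _ ≤ δ * (K * (2 + W)) * (K * (2 * Q t + 1 + W)) :=
        mul_le_mul_of_nonneg_left (mul_le_mul_of_nonneg_left (by linarith) hK) (by positivity)
    _ = δ * B := by rw [hB]; ring

/-- Covariation of two pathwise integrals, as a limit independent of the approximating sums. -/
lemma exists_covariation {G : GridSeq} {X Q ξ ζ Y Z : ℝ → ℝ}
    (hX : ContinuousOn X (Ici 0)) (hQ : HasQV G X Q)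
    (hξ : Admissible X ξ) (hζ : Admissible X ζ)
    (hY : ∀ t, ConvTo G (fun u v => ξ u * (X v - X u)) t (Y t))
    (hZ : ∀ t, ConvTo G (fun u v => ζ u * (X v - X u)) t (Z t)) :
    ∃ R : ℝ → ℝ, ContinuousOn R (Ici 0) ∧ R 0 = 0 ∧
      (∀ t, ConvTo G (fun u v => (Y v - Y u) * (Z v - Z u)) t (R t)) ∧
      ∀ t, ConvTo G (fun u v => ξ u * ζ u * (Q v - Q u)) t (R t) := by
  have hξc := hξ.continuousOn hX
  have hζc := hζ.continuousOn hX
  have hQ0 : ∀ t ≤ 0, Q t = 0 := fun t ht => (hQ.2.2 t).eq_zero ht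
  have hsq : ∀ u v, u ≤ v → 0 ≤ (X v - X u) ^ 2 := fun _ _ _ => sq_nonneg _
  have hweighted : ∀ φ : ℝ → ℝ, ContinuousOn φ (Ici 0) →
      ∀ t, ∃ L, ConvTo G (fun u v => (φ u * (X v - X u)) ^ 2) t L := by
    intro φ hφ t
    obtain ⟨R, -, -, hR⟩ := exists_weighted_limit G hQ.monotone hQ.1 hQ0 (hφ.pow 2)
    refine ⟨R t, ?_⟩
    simpa only [mul_pow, Pi.pow_apply] using hR (fun u v => (X v - X u) ^ 2) hsq hQ.2.2 t
  obtain ⟨R, hRc, hR0, hR⟩ := exists_weighted_limit G hQ.monotone hQ.1 hQ0 (hξc.mul hζc)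
  refine ⟨R, hRc, hR0, fun t => ?_,
    hR _ (fun u v huv => sub_nonneg.2 (hQ.monotone huv)) (convTo_increment G hQ.1 hQ0)⟩
  obtain ⟨L, hL⟩ := hweighted ξ hξc t
  obtain ⟨M, hM⟩ := hweighted ζ hζc t
  have hY2 := convTo_remainder_sq hX hQ hξ hY t
  have hZ2 := convTo_remainder_sq hX hQ hζ hZ t
  have := ((hR _ hsq hQ.2.2 t).add (hL.mul_zero_of_sq hZ2)).add
    ((hM.mul_zero_of_sq hY2).add (hY2.mul_zero_of_sq hZ2))
  rw [add_zero, add_zero, add_zero] at this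
  convert this using 3 with u v
  unfold remainder
  simp only [Pi.mul_apply]
  ring

/-- covariation of pathwise Itô integrals:
`[∫ ξ dX, ∫ ζ dX]_t = ∫_0^t ξ ζ d[X]`. -/
theorem stmt10 (G : GridSeq) (X Q ξ ζ Y Z : ℝ → ℝ)
    (hX : ContinuousOn X (Set.Ici 0)) (hQ : HasQV G X Q)
    (hξ : Admissible X ξ) (hζ : Admissible X ζ)
    (hY : ∀ t, ConvTo G (fun u v => ξ u * (X v - X u)) t (Y t)) (hY0 : Y 0 = 0)
    (hZ : ∀ t, ConvTo G (fun u v => ζ u * (X v - X u)) t (Z t)) (hZ0 : Z 0 = 0) :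
    ContinuousOn Y (Set.Ici 0) ∧ ContinuousOn Z (Set.Ici 0) ∧
    ∃ QY QZ R : ℝ → ℝ,
      HasQV G Y QY ∧ HasQV G Z QZ ∧
      (ContinuousOn R (Set.Ici 0) ∧ R 0 = 0 ∧
        ∀ t, ConvTo G (fun u v => (Y v - Y u) * (Z v - Z u)) t (R t)) ∧
      ∀ t, ConvTo G (fun u v => ξ u * ζ u * (Q v - Q u)) t (R t) := by
  obtain ⟨R, hRc, hR0, hR, hRQ⟩ := exists_covariation hX hQ hξ hζ hY hZ
  obtain ⟨QY, hQYc, hQY0, hQY, -⟩ := exists_covariation hX hQ hξ hξ hY hY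
  obtain ⟨QZ, hQZc, hQZ0, hQZ, -⟩ := exists_covariation hX hQ hζ hζ hZ hZ
  exact ⟨continuousOn_pathwise_integral hX hQ hξ hY, continuousOn_pathwise_integral hX hQ hζ hZ,
    QY, QZ, R, ⟨hQYc, hQY0, by simpa only [sq] using hQY⟩,
    ⟨hQZc, hQZ0, by simpa only [sq] using hQZ⟩, ⟨hRc, hR0, hR⟩, hRQ⟩
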